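/- Let δ > 0, n ∈ ℕ, c₀ := max_{x∈𝒳} |log(p₀*(x)/q₀*(x))|, and τ_{0,n} := inf{t ∈ ℕ : S_{0,t} ≥ n(D(q₁*‖p₁*) − δ)}. For any adaptive adversary strategy for H₀ (law ℙ), if D(q₁*‖p₁*) − δ ≤ D(p₀*‖q₀*) − δ holds in the sense that n(D(q₁*‖p₁*) − δ) ≤ n·D(p₀*‖q₀*) − nδ, then ℙ(τ_{0,n} > n) ≤ ℙ(S_{0,n} < n·D(p₀*‖q₀*) − nδ) ≤ exp(−nδ²/(8c₀²)). In particular, ℙ(M_{0,n} < −nδ) ≤ exp(−nδ²/(8c₀²)), where M_{0,n} := S_{0,n} − n·D(p₀*‖q₀*). -/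

import Mathlib

open scoped BigOperators ENNReal

variable {𝒳 : Type*}

/-- A probability mass function on the finite alphabet `𝒳`. -/
def IsDist [Fintype 𝒳] (f : 𝒳 → ℝ) : Prop :=
  (∀ x, 0 ≤ f x) ∧ ∑ x, f x = 1

/-- Kullback–Leibler divergence `D(p‖q) = ∑ₓ p(x) log (p(x)/q(x))`. -/
noncomputable def KL [Fintype 𝒳] (p q : 𝒳 → ℝ) : ℝ :=
  ∑ x, p x * Real.log (p x / q x)

/-- Probability of observing the finite sequence `l` under the adaptive strategy `str`:
`ℙ(x^t) = ∏ᵢ str(x^{i-1})(xᵢ)`. -/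
noncomputable def seqProb [Fintype 𝒳] (str : List 𝒳 → 𝒳 → ℝ) (l : List 𝒳) : ℝ :=
  ∏ i : Fin l.length, str (l.take i.1) (l.get i)

/-- Log-likelihood-ratio sum `S_t = ∑ᵢ log (p(xᵢ)/q(xᵢ))`. -/
noncomputable def llSum (p q : 𝒳 → ℝ) (l : List 𝒳) : ℝ :=
  ∑ i : Fin l.length, Real.log (p (l.get i) / q (l.get i))

/-- An adaptive adversary strategy choosing, after each history, a distribution in `P`. -/
def IsStrategy (P : Set (𝒳 → ℝ)) (str : List 𝒳 → 𝒳 → ℝ) : Prop :=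
  ∀ l, str l ∈ P

open Classical in
/-- Probability that the first `n` observations form a sequence satisfying `E`. -/
noncomputable def probAt [Fintype 𝒳] (str : List 𝒳 → 𝒳 → ℝ) (n : ℕ)
    (E : List 𝒳 → Prop) : ℝ :=
  ∑ x : Fin n → 𝒳, if E (List.ofFn x) then seqProb str (List.ofFn x) else 0

/-- No prefix of `l` (including `l` itself) lies in the stopping region `B`;
for `l` of length `n` this is the event `{τ_B > n}`. -/
def notYet (B : List 𝒳 → Prop) (l : List 𝒳) : Prop :=
  ∀ t ≤ l.length, ¬ B (l.take t)

/-- `l` is a stopped sequence of the first-hitting time `τ_B` of the region `B`. -/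
def stopsAt (B : List 𝒳 → Prop) (l : List 𝒳) : Prop :=
  B l ∧ ∀ t < l.length, ¬ B (l.take t)

/-- Expected stopping time `E[τ_B] = ∑_{n ≥ 0} ℙ(τ_B > n)`, valued in `ℝ≥0∞`. -/
noncomputable def expTau [Fintype 𝒳] (str : List 𝒳 → 𝒳 → ℝ) (B : List 𝒳 → Prop) : ℝ≥0∞ :=
  ∑' n : ℕ, ENNReal.ofReal (probAt str n (notYet B))

open Classical in
/-- Expectation of `f` evaluated at the stopped sequence `X^{τ_B}`. -/
noncomputable def expStopped [Fintype 𝒳] (str : List 𝒳 → 𝒳 → ℝ) (B : List 𝒳 → Prop)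
    (f : List 𝒳 → ℝ) : ℝ :=
  ∑' l : List 𝒳, if stopsAt B l then seqProb str l * f l else 0

open Classical in
/-- Probability that the process stops (via `B`) at a sequence satisfying `E`. -/
noncomputable def probStopIn [Fintype 𝒳] (str : List 𝒳 → 𝒳 → ℝ) (B : List 𝒳 → Prop)
    (E : List 𝒳 → Prop) : ℝ :=
  ∑' l : List 𝒳, if stopsAt B l ∧ E l then seqProb str l else 0

lemma seqProb_nil [Fintype 𝒳] (str : List 𝒳 → 𝒳 → ℝ) : seqProb str [] = 1 :=
  Fin.prod_univ_zero _

lemma llSum_nil (p q : 𝒳 → ℝ) : llSum p q [] = 0 :=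
  Fin.sum_univ_zero _

lemma seqProb_cons [Fintype 𝒳] (str : List 𝒳 → 𝒳 → ℝ) (a : 𝒳) (l : List 𝒳) :
    seqProb str (a :: l) = str [] a * seqProb (fun h => str (a :: h)) l := by
  unfold seqProb
  exact (Fin.prod_univ_succ _).trans (by simp)

lemma llSum_cons (p q : 𝒳 → ℝ) (a : 𝒳) (l : List 𝒳) :
    llSum p q (a :: l) = Real.log (p a / q a) + llSum p q l := by
  unfold llSum
  exact (Fin.sum_univ_succ _).trans (by simp)

lemma seqProb_nonneg [Fintype 𝒳] {str : List 𝒳 → 𝒳 → ℝ} (h : ∀ l x, 0 ≤ str l x)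
    (l : List 𝒳) : 0 ≤ seqProb str l :=
  Finset.prod_nonneg fun _ _ => h _ _

lemma sum_ofFn_succ [Fintype 𝒳] (n : ℕ) (F : List 𝒳 → ℝ) :
    ∑ x : Fin (n + 1) → 𝒳, F (List.ofFn x) =
      ∑ a, ∑ y : Fin n → 𝒳, F (a :: List.ofFn y) := by
  rw [← Fintype.sum_prod_type']
  refine (Fintype.sum_equiv (Fin.consEquiv fun _ => 𝒳) _ _ fun z => ?_).symm
  simp [Fin.consEquiv, List.ofFn_succ]

/-- Monotonicity of `probAt` in the event. -/
lemma probAt_mono [Fintype 𝒳] {str : List 𝒳 → 𝒳 → ℝ} (hstr : ∀ l x, 0 ≤ str l x) {n : ℕ}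
    {E F : List 𝒳 → Prop} (h : ∀ l, l.length = n → E l → F l) :
    probAt str n E ≤ probAt str n F := by
  classical
  refine Finset.sum_le_sum fun x _ => ?_
  have hnn := seqProb_nonneg hstr (List.ofFn x)
  have hx := h (List.ofFn x) (by simp)
  split_ifs <;> simp_all

/-- A one-step bound on the moment generating function of the centred log-likelihood ratio
propagates along adaptive strategies. -/
lemma sum_seqProb_mul_exp_le_pow [Fintype 𝒳] {P : Set (𝒳 → ℝ)}
    (hP : ∀ p ∈ P, ∀ x, 0 ≤ p x) {p q : 𝒳 → ℝ} {s D B : ℝ}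
    (hB : ∀ r ∈ P, ∑ x, r x * Real.exp (-s * (Real.log (p x / q x) - D)) ≤ B)
    (hB0 : 0 ≤ B) (n : ℕ) :
    ∀ str : List 𝒳 → 𝒳 → ℝ, IsStrategy P str →
      ∑ x : Fin n → 𝒳, seqProb str (List.ofFn x) *
        Real.exp (-s * (llSum p q (List.ofFn x) - n * D)) ≤ B ^ n := by
  induction n with
  | zero => intro str _; simp [seqProb_nil, llSum_nil]
  | succ n ih =>
    intro str hstr
    rw [sum_ofFn_succ n fun l => seqProb str l * Real.exp (-s * (llSum p q l - (n + 1 : ℕ) * D))]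
    calc ∑ a, ∑ y : Fin n → 𝒳, seqProb str (a :: List.ofFn y) *
            Real.exp (-s * (llSum p q (a :: List.ofFn y) - (n + 1 : ℕ) * D))
        = ∑ a, str [] a * Real.exp (-s * (Real.log (p a / q a) - D)) *
            ∑ y : Fin n → 𝒳, seqProb (fun h => str (a :: h)) (List.ofFn y) *
              Real.exp (-s * (llSum p q (List.ofFn y) - n * D)) := by
          refine Finset.sum_congr rfl fun a _ => ?_
          rw [Finset.mul_sum]
          refine Finset.sum_congr rfl fun y _ => ?_
          have hexp : Real.exp (-s * (llSum p q (a :: List.ofFn y) - (n + 1 : ℕ) * D)) =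
              Real.exp (-s * (Real.log (p a / q a) - D)) *
                Real.exp (-s * (llSum p q (List.ofFn y) - n * D)) := by
            rw [← Real.exp_add, llSum_cons]
            congr 1
            push_cast
            ring
          rw [hexp, seqProb_cons]
          ring
      _ ≤ ∑ a, str [] a * Real.exp (-s * (Real.log (p a / q a) - D)) * B ^ n := by
          refine Finset.sum_le_sum fun a _ => ?_
          exact mul_le_mul_of_nonneg_left (ih _ fun l => hstr _)
            (mul_nonneg (hP _ (hstr _) _) (Real.exp_nonneg _))
      _ = (∑ a, str [] a * Real.exp (-s * (Real.log (p a / q a) - D))) * B ^ n := by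
          rw [Finset.sum_mul]
      _ ≤ B ^ (n + 1) := by
          rw [pow_succ']
          exact mul_le_mul_of_nonneg_right (hB _ (hstr _)) (pow_nonneg hB0 n)

/-- The chord bound for `exp` on a symmetric interval. -/
lemma exp_neg_mul_le_cosh_sub {s a y : ℝ} (h : |y| ≤ a) :
    Real.exp (-s * y) ≤ Real.cosh (s * a) - y / a * Real.sinh (s * a) := by
  rcases ((abs_nonneg y).trans h).eq_or_lt with rfl | ha
  · have hy : y = 0 := abs_nonpos_iff.mp h
    simp [hy]
  · obtain ⟨h1, h2⟩ := abs_le.mp h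
    have hya : y / a ≤ 1 := (div_le_one ha).mpr h2
    have hya' : -1 ≤ y / a := by rw [le_div_iff₀ ha]; linarith
    have hc := convexOn_exp.2 (Set.mem_univ (s * a)) (Set.mem_univ (-(s * a)))
      (show (0 : ℝ) ≤ (1 - y / a) / 2 by linarith) (show (0 : ℝ) ≤ (1 + y / a) / 2 by linarith)
      (by ring)
    simp only [smul_eq_mul] at hc
    have he : (1 - y / a) / 2 * (s * a) + (1 + y / a) / 2 * -(s * a) = -s * y := by
      field_simp
      ring
    rw [he] at hc
    rw [Real.cosh_eq, Real.sinh_eq]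
    linarith

/-- One-sided Hoeffding bound for a bounded variable with nonnegative mean. -/
lemma sum_mul_exp_le [Fintype 𝒳] {r Y : 𝒳 → ℝ} (hr : IsDist r) {s a : ℝ} (hs : 0 ≤ s)
    (ha : 0 ≤ a) (hY : ∀ x, |Y x| ≤ a) (hmean : 0 ≤ ∑ x, r x * Y x) :
    ∑ x, r x * Real.exp (-s * Y x) ≤ Real.exp ((s * a) ^ 2 / 2) := by
  have hsinh : 0 ≤ Real.sinh (s * a) := Real.sinh_nonneg_iff.mpr (mul_nonneg hs ha)
  calc ∑ x, r x * Real.exp (-s * Y x)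
      ≤ ∑ x, r x * (Real.cosh (s * a) - Y x / a * Real.sinh (s * a)) :=
        Finset.sum_le_sum fun x _ =>
          mul_le_mul_of_nonneg_left (exp_neg_mul_le_cosh_sub (hY x)) (hr.1 x)
    _ = (∑ x, r x) * Real.cosh (s * a) - (∑ x, r x * Y x) * (Real.sinh (s * a) / a) := by
        rw [Finset.sum_mul, Finset.sum_mul, ← Finset.sum_sub_distrib]
        exact Finset.sum_congr rfl fun x _ => by ring
    _ ≤ Real.cosh (s * a) := by
        rw [hr.2]
        linarith [mul_nonneg hmean (div_nonneg hsinh ha)]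
    _ ≤ _ := Real.cosh_le_exp_half_sq _

/-- First-order optimality of a minimiser of `KL · q` over a convex set of distributions with
common support. -/
lemma KL_le_sum_mul_log [Fintype 𝒳] {P : Set (𝒳 → ℝ)} (hP : ∀ p ∈ P, IsDist p)
    (hPconv : Convex ℝ P) {p₀ q : 𝒳 → ℝ} (hp₀ : p₀ ∈ P)
    (hac : ∀ p ∈ P, ∀ x, (p x = 0 ↔ q x = 0)) (hmin : ∀ p ∈ P, KL p₀ q ≤ KL p q)
    {p : 𝒳 → ℝ} (hp : p ∈ P) :
    KL p₀ q ≤ ∑ x, p x * Real.log (p₀ x / q x) := by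
  set C := ∑ x, (p x - p₀ x) ^ 2 / p₀ x with hC
  set w := (∑ x, p x * Real.log (p₀ x / q x)) - KL p₀ q with hw
  have hC0 : 0 ≤ C := Finset.sum_nonneg fun x _ => div_nonneg (sq_nonneg _) ((hP _ hp₀).1 x)
  have key : ∀ t : ℝ, 0 < t → t ≤ 1 → 0 ≤ t * w + t ^ 2 * C := by
    intro t ht0 ht1
    have hmem : (1 - t) • p₀ + t • p ∈ P :=
      hPconv hp₀ hp (by linarith) ht0.le (by ring)
    have hle := hmin _ hmem
    have hterm : ∀ x, ((1 - t) • p₀ + t • p) x *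
          Real.log (((1 - t) • p₀ + t • p) x / q x) ≤
        (1 - t) * (p₀ x * Real.log (p₀ x / q x)) + t * (p x * Real.log (p₀ x / q x)) +
          t * (p x - p₀ x) + t ^ 2 * ((p x - p₀ x) ^ 2 / p₀ x) := by
      intro x
      simp only [Pi.add_apply, Pi.smul_apply, smul_eq_mul]
      by_cases hx : q x = 0
      · simp [(hac _ hp₀ x).mpr hx, (hac _ hp x).mpr hx]
      have h0 : p₀ x ≠ 0 := fun h => hx ((hac _ hp₀ x).mp h)
      have h0' : 0 < p₀ x := lt_of_le_of_ne ((hP _ hp₀).1 x) h0.symm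
      have hpt : 0 < (1 - t) * p₀ x + t * p x := by
        have h1 : (1 - t) * p₀ x + t * p x ≠ 0 := fun h => hx ((hac _ hmem x).mp h)
        exact lt_of_le_of_ne ((hP _ hmem).1 x) h1.symm
      set u := (1 - t) * p₀ x + t * p x with hu
      have hlog : Real.log (u / q x) = Real.log (p₀ x / q x) + Real.log (u / p₀ x) := by
        rw [Real.log_div hpt.ne' hx, Real.log_div h0 hx, Real.log_div hpt.ne' h0]
        ring
      have hb : u * Real.log (u / p₀ x) ≤ u * (u / p₀ x - 1) :=
        mul_le_mul_of_nonneg_left (Real.log_le_sub_one_of_pos (div_pos hpt h0')) hpt.le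
      have he : u * (u / p₀ x - 1) =
          t * (p x - p₀ x) + t ^ 2 * ((p x - p₀ x) ^ 2 / p₀ x) := by
        rw [hu]
        field_simp
        ring
      have hs : u * Real.log (p₀ x / q x) =
          (1 - t) * (p₀ x * Real.log (p₀ x / q x)) + t * (p x * Real.log (p₀ x / q x)) := by
        rw [hu]
        ring
      rw [hlog, mul_add]
      linarith
    have hsum : KL ((1 - t) • p₀ + t • p) q ≤ _ := Finset.sum_le_sum fun x _ => hterm x
    simp only [Finset.sum_add_distrib, ← Finset.mul_sum, Finset.sum_sub_distrib,
      (hP _ hp).2, (hP _ hp₀).2] at hsum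
    rw [← hC] at hsum
    change _ ≤ (1 - t) * KL p₀ q + _ + _ + _ at hsum
    rw [hw]
    linarith
  by_contra! hlt
  have hwneg : w < 0 := by rw [hw]; linarith
  have hd : 0 < C - w := by linarith
  have ht0 : 0 < -w / (C - w) := div_pos (by linarith) hd
  have h := key _ ht0 ((div_le_one hd).mpr (by linarith))
  have h2 : -w / (C - w) * w + (-w / (C - w)) ^ 2 * C = -(-w / (C - w)) ^ 2 * (-w) := by
    field_simp
    ring
  have h3 : 0 < (-w / (C - w)) ^ 2 * (-w) := mul_pos (pow_pos ht0 2) (by linarith)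
  linarith

/-- Azuma–Hoeffding bound for the log-likelihood ratio under an adaptive strategy. -/
lemma probAt_llSum_lt_le [Fintype 𝒳] {P : Set (𝒳 → ℝ)} (hP : ∀ p ∈ P, IsDist p)
    {p q : 𝒳 → ℝ} {D c : ℝ} (hc : ∀ x, |Real.log (p x / q x)| ≤ c) (hD : |D| ≤ c)
    (hmean : ∀ r ∈ P, D ≤ ∑ x, r x * Real.log (p x / q x))
    {str : List 𝒳 → 𝒳 → ℝ} (hstr : IsStrategy P str) {δ : ℝ} (hδ : 0 ≤ δ) (n : ℕ) :
    probAt str n (fun l => llSum p q l < n * D - n * δ) ≤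
      Real.exp (-(n * δ ^ 2 / (8 * c ^ 2))) := by
  classical
  have hc0 : 0 ≤ c := (abs_nonneg D).trans hD
  set s := δ / (4 * c ^ 2) with hs
  have hs0 : 0 ≤ s := by positivity
  have hnn : ∀ l, 0 ≤ seqProb str l := seqProb_nonneg fun l => (hP _ (hstr l)).1
  have hstep : ∀ r ∈ P, ∑ x, r x * Real.exp (-s * (Real.log (p x / q x) - D)) ≤
      Real.exp ((s * (2 * c)) ^ 2 / 2) := by
    intro r hr
    refine sum_mul_exp_le (hP r hr) hs0 (by linarith)
      (fun x => (abs_sub _ _).trans (by linarith [hc x])) ?_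
    simp only [mul_sub, Finset.sum_sub_distrib, ← Finset.sum_mul, (hP r hr).2]
    linarith [hmean r hr]
  have hmgf := sum_seqProb_mul_exp_le_pow (fun p hp => (hP p hp).1) hstep
    (Real.exp_nonneg _) n str hstr
  calc probAt str n (fun l => llSum p q l < n * D - n * δ)
      ≤ ∑ x : Fin n → 𝒳, Real.exp (-s * (n * δ)) * (seqProb str (List.ofFn x) *
          Real.exp (-s * (llSum p q (List.ofFn x) - n * D))) := by
        refine Finset.sum_le_sum fun x _ => ?_
        have hx := hnn (List.ofFn x)
        split_ifs with h
        · rw [mul_left_comm, ← Real.exp_add]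
          refine le_mul_of_one_le_right hx (Real.one_le_exp ?_)
          have := mul_nonneg hs0 (sub_nonneg.mpr h.le)
          linarith
        · positivity
    _ ≤ Real.exp (-s * (n * δ)) * Real.exp ((s * (2 * c)) ^ 2 / 2) ^ n := by
        rw [← Finset.mul_sum]
        exact mul_le_mul_of_nonneg_left hmgf (Real.exp_nonneg _)
    _ = Real.exp (-(n * δ ^ 2 / (8 * c ^ 2))) := by
        rw [← Real.exp_nat_mul, ← Real.exp_add]
        congr 1
        rw [hs]
        rcases eq_or_ne c 0 with rfl | hne
        · simp
        · field_simp
          ring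

/-- Let `δ > 0`, `c₀ = max_x |log(p₀*(x)/q₀*(x))|` and
`τ_{0,n} = inf{t : S_{0,t} ≥ n(D(q₁*‖p₁*) − δ)}`.  For any adaptive adversary strategy for
`H₀` (law `ℙ`), if `n(D(q₁*‖p₁*) − δ) ≤ n·D(p₀*‖q₀*) − nδ` then
`ℙ(τ_{0,n} > n) ≤ ℙ(S_{0,n} < n·D(p₀*‖q₀*) − nδ) ≤ exp(−nδ²/(8c₀²))`; in particular
`ℙ(M_{0,n} < −nδ) ≤ exp(−nδ²/(8c₀²))` where `M_{0,n} = S_{0,n} − n·D(p₀*‖q₀*)`. -/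
theorem stmt16 [Fintype 𝒳] [Nonempty 𝒳]
    (P Q : Set (𝒳 → ℝ))
    (hP : ∀ p ∈ P, IsDist p) (hQ : ∀ q ∈ Q, IsDist q)
    (hPclosed : IsClosed P) (hQclosed : IsClosed Q)
    (hPconv : Convex ℝ P) (hQconv : Convex ℝ Q)
    (hdisj : Disjoint P Q)
    (hac : ∀ p ∈ P, ∀ q ∈ Q, ∀ x, (p x = 0 ↔ q x = 0))
    (p₀ q₀ : 𝒳 → ℝ) (hp₀ : p₀ ∈ P) (hq₀ : q₀ ∈ Q)
    (hmin₀ : ∀ p ∈ P, ∀ q ∈ Q, KL p₀ q₀ ≤ KL p q)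
    (p₁ q₁ : 𝒳 → ℝ) (hp₁ : p₁ ∈ P) (hq₁ : q₁ ∈ Q)
    (hmin₁ : ∀ p ∈ P, ∀ q ∈ Q, KL q₁ p₁ ≤ KL q p)
    (strP : List 𝒳 → 𝒳 → ℝ) (hstrP : IsStrategy P strP)
    (c₀ : ℝ) (hc₀ : c₀ = ⨆ x, |Real.log (p₀ x / q₀ x)|)
    (δ : ℝ) (hδ : 0 < δ) (n : ℕ)
    (hth : (n : ℝ) * (KL q₁ p₁ - δ) ≤ (n : ℝ) * KL p₀ q₀ - n * δ) :
    probAt strP n (notYet (fun l => (n : ℝ) * (KL q₁ p₁ - δ) ≤ llSum p₀ q₀ l)) ≤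
      probAt strP n (fun l => llSum p₀ q₀ l < (n : ℝ) * KL p₀ q₀ - n * δ) ∧
    probAt strP n (fun l => llSum p₀ q₀ l < (n : ℝ) * KL p₀ q₀ - n * δ) ≤
      Real.exp (-((n : ℝ) * δ ^ 2 / (8 * c₀ ^ 2))) ∧
    probAt strP n (fun l => llSum p₀ q₀ l - (n : ℝ) * KL p₀ q₀ < -((n : ℝ) * δ)) ≤
      Real.exp (-((n : ℝ) * δ ^ 2 / (8 * c₀ ^ 2))) := by
  have hstr : ∀ l x, 0 ≤ strP l x := fun l => (hP _ (hstrP l)).1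
  have hc : ∀ x, |Real.log (p₀ x / q₀ x)| ≤ c₀ := fun x =>
    hc₀ ▸ le_ciSup (f := fun x => |Real.log (p₀ x / q₀ x)|) (Set.finite_range _).bddAbove x
  have hD : |KL p₀ q₀| ≤ c₀ := by
    calc |KL p₀ q₀| ≤ ∑ x, |p₀ x * Real.log (p₀ x / q₀ x)| := Finset.abs_sum_le_sum_abs _ _
      _ ≤ ∑ x, p₀ x * c₀ := Finset.sum_le_sum fun x _ => by
          rw [abs_mul, abs_of_nonneg ((hP _ hp₀).1 x)]
          exact mul_le_mul_of_nonneg_left (hc x) ((hP _ hp₀).1 x)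
      _ = c₀ := by rw [← Finset.sum_mul, (hP _ hp₀).2, one_mul]
  have hbound := probAt_llSum_lt_le hP hc hD
    (fun r hr => KL_le_sum_mul_log hP hPconv hp₀ (fun p hp => hac p hp q₀ hq₀)
      (fun p hp => hmin₀ p hp q₀ hq₀) hr) hstrP hδ.le n
  refine ⟨probAt_mono hstr fun l hl h => ?_, hbound,
    (probAt_mono hstr fun l _ h => ?_).trans hbound⟩
  · have h' := h l.length le_rfl
    rw [List.take_length, not_le] at h'
    exact h'.trans_le hth
  · linarith
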